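/- The element Ω := ı^{-1} g_L^{-1} h g_L^{-1} satisfies: (1) Ω = ı^{-1} g_R^{-1} h g_R^{-1} = (ı g_L g_R)^{-1/2} h (ı g_L g_R)^{-1/2}; (2) Ω is a positive element of A; (3) Ω² = Ω = Ω* = S(Ω) = J(Ω); (4) Ω is cocentral, i.e. Ω_{(1)} ⊗ Ω_{(2)} = Ω_{(2)} ⊗ Ω_{(1)}; and (5) Ω is non-degenerate: for every y ∈ A there exist φ, ψ ∈ A* with ⟨φ, Ω_{(1)}⟩ Ω_{(2)} = y = Ω_{(1)} ⟨ψ, Ω_{(2)}⟩. -/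

import Mathlib

open scoped TensorProduct

noncomputable section

/-- An element of a `C*`-algebra is positive iff it is of the form `star y * y`. -/
def IsPosElem {A : Type*} [Mul A] [Star A] (x : A) : Prop := ∃ y : A, x = star y * y

section Helpers

variable {A : Type*} [NormedRing A] [StarRing A] [CStarRing A]
  [NormedAlgebra ℂ A] [StarModule ℂ A]

/-- Apply a linear functional to the first leg of a tensor (`⟨φ, u₁⟩ u₂`). -/
def lapp (φ : A →ₗ[ℂ] ℂ) : A ⊗[ℂ] A →ₗ[ℂ] A :=
  (TensorProduct.lid ℂ A).toLinearMap ∘ₗ TensorProduct.map φ LinearMap.id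

/-- Apply a linear functional to the second leg of a tensor (`⟨φ, u₂⟩ u₁`). -/
def rapp (φ : A →ₗ[ℂ] ℂ) : A ⊗[ℂ] A →ₗ[ℂ] A :=
  (TensorProduct.rid ℂ A).toLinearMap ∘ₗ TensorProduct.map LinearMap.id φ

/-- Apply a pair of linear functionals to the two legs of a tensor (`⟨φ, u₁⟩⟨ψ, u₂⟩`). -/
def papp (φ ψ : A →ₗ[ℂ] ℂ) : A ⊗[ℂ] A →ₗ[ℂ] ℂ :=
  (TensorProduct.lid ℂ ℂ).toLinearMap ∘ₗ TensorProduct.map φ ψ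

end Helpers

/-- A `C*`-weak Hopf algebra: a finite-dimensional unital `C*`-algebra `A` equipped with a
comultiplication `Δ` (written in Sweedler notation `Δ x = x₍₁₎ ⊗ x₍₂₎`), counit `ε` and
antipode `S`, satisfying the axioms of Böhm–Szlachányi.  The field `starT` is the
(componentwise) star operation on `A ⊗[ℂ] A`, characterized by additivity and its values on
pure tensors. -/
structure WeakHopfData (A : Type*) [NormedRing A] [StarRing A] [CStarRing A]
    [NormedAlgebra ℂ A] [StarModule ℂ A] [FiniteDimensional ℂ A] : Type _ where
  Δ : A →ₗ[ℂ] A ⊗[ℂ] A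
  ε : A →ₗ[ℂ] ℂ
  S : A ≃ₗ[ℂ] A
  starT : A ⊗[ℂ] A → A ⊗[ℂ] A
  starT_add : ∀ u v : A ⊗[ℂ] A, starT (u + v) = starT u + starT v
  starT_tmul : ∀ a b : A, starT (a ⊗ₜ[ℂ] b) = star a ⊗ₜ[ℂ] star b
  /-- coassociativity of the comultiplication -/
  coassoc : (TensorProduct.assoc ℂ A A A).toLinearMap ∘ₗ
      (TensorProduct.map Δ LinearMap.id) ∘ₗ Δ = (TensorProduct.map LinearMap.id Δ) ∘ₗ Δ
  /-- counit axiom, left version -/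
  counit_left : (TensorProduct.lid ℂ A).toLinearMap ∘ₗ (TensorProduct.map ε LinearMap.id) ∘ₗ Δ
      = LinearMap.id
  /-- counit axiom, right version -/
  counit_right : (TensorProduct.rid ℂ A).toLinearMap ∘ₗ (TensorProduct.map LinearMap.id ε) ∘ₗ Δ
      = LinearMap.id
  /-- the comultiplication is multiplicative -/
  Δ_mul : ∀ x y : A, Δ (x * y) = Δ x * Δ y
  /-- the star operation is comultiplicative -/
  Δ_star : ∀ x : A, Δ (star x) = starT (Δ x)
  /-- the unit is weakly comultiplicative:
  `(Δ ⊗ id)(Δ 1) = (Δ 1 ⊗ 1)(1 ⊗ Δ 1)` -/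
  Δ_one_weak : (TensorProduct.map Δ LinearMap.id) (Δ 1)
      = (Δ 1 ⊗ₜ[ℂ] (1 : A)) * ((TensorProduct.assoc ℂ A A A).symm ((1 : A) ⊗ₜ[ℂ] Δ 1))
  /-- the unit is weakly comultiplicative:
  `(Δ ⊗ id)(Δ 1) = (1 ⊗ Δ 1)(Δ 1 ⊗ 1)` -/
  Δ_one_weak' : (TensorProduct.map Δ LinearMap.id) (Δ 1)
      = ((TensorProduct.assoc ℂ A A A).symm ((1 : A) ⊗ₜ[ℂ] Δ 1)) * (Δ 1 ⊗ₜ[ℂ] (1 : A))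
  /-- the counit is weakly multiplicative: `ε (x y z) = ε (x y₍₁₎) ε (y₍₂₎ z)` -/
  ε_weak : ∀ x y z : A,
      ε (x * y * z) = papp (ε ∘ₗ LinearMap.mulLeft ℂ x) (ε ∘ₗ LinearMap.mulRight ℂ z) (Δ y)
  /-- the counit is weakly multiplicative: `ε (x y z) = ε (x y₍₂₎) ε (y₍₁₎ z)` -/
  ε_weak' : ∀ x y z : A,
      ε (x * y * z) = papp (ε ∘ₗ LinearMap.mulRight ℂ z) (ε ∘ₗ LinearMap.mulLeft ℂ x) (Δ y)
  /-- antipode axiom: `x₍₁₎ S(x₍₂₎) = ε (1₍₁₎ x) 1₍₂₎` -/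
  antipode_left : ∀ x : A,
      LinearMap.mul' ℂ A ((TensorProduct.map LinearMap.id S.toLinearMap) (Δ x))
        = lapp (ε ∘ₗ LinearMap.mulRight ℂ x) (Δ 1)
  /-- antipode axiom: `S(x₍₁₎) x₍₂₎ = 1₍₁₎ ε (x 1₍₂₎)` -/
  antipode_right : ∀ x : A,
      LinearMap.mul' ℂ A ((TensorProduct.map S.toLinearMap LinearMap.id) (Δ x))
        = rapp (ε ∘ₗ LinearMap.mulLeft ℂ x) (Δ 1)
  /-- the antipode is antimultiplicative -/
  S_antimul : ∀ x y : A, S (x * y) = S y * S x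
  /-- the antipode is anticomultiplicative -/
  S_anticomul : ∀ x : A,
      Δ (S x) = (TensorProduct.comm ℂ A A) ((TensorProduct.map S.toLinearMap S.toLinearMap) (Δ x))

namespace WeakHopfData

variable {A : Type*} [NormedRing A] [StarRing A] [CStarRing A]
  [NormedAlgebra ℂ A] [StarModule ℂ A] [FiniteDimensional ℂ A]

/-- The source counital map `ε^L (x) = x₍₁₎ S(x₍₂₎)`. -/
def εL (W : WeakHopfData A) : A →ₗ[ℂ] A :=
  LinearMap.mul' ℂ A ∘ₗ TensorProduct.map LinearMap.id W.S.toLinearMap ∘ₗ W.Δ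

/-- The target counital map `ε^R (x) = S(x₍₁₎) x₍₂₎`. -/
def εR (W : WeakHopfData A) : A →ₗ[ℂ] A :=
  LinearMap.mul' ℂ A ∘ₗ TensorProduct.map W.S.toLinearMap LinearMap.id ∘ₗ W.Δ

/-- Full contraction of the iterated coproduct `Δ⁽ⁿ⁾ x = x₍₁₎ ⊗ ⋯ ⊗ x₍ₙ₊₁₎` against a family
of `n+1` linear functionals: `sweedlerEval W n φ x = ⟨φ 0, x₍₁₎⟩ ⋯ ⟨φ n, x₍ₙ₊₁₎⟩`.
Since linear functionals separate the points of a tensor power, identities between iterated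
coproducts are faithfully expressed through these contractions. -/
def sweedlerEval (W : WeakHopfData A) : (n : ℕ) → (Fin (n + 1) → (A →ₗ[ℂ] ℂ)) → (A →ₗ[ℂ] ℂ)
  | 0, φ => φ 0
  | n + 1, φ => papp (sweedlerEval W n (Fin.init φ)) (φ (Fin.last (n + 1))) ∘ₗ W.Δ

end WeakHopfData

/-- A `C*`-weak Hopf algebra together with its canonical distinguished elements:
the Haar integral `h`, the dual Haar integral `hHat`, the square roots `gL`, `gR` of
`E^L h`, `E^R h` (whence the canonical grouplike element `g = gL * gR⁻¹`), real powers
`gLpow`, `gRpow` of `gL` and `gR`, and a positive square root operation `sqrt`;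
all characterized by the (uniquely determining) properties listed as fields. -/
structure HaarPkg (A : Type*) [NormedRing A] [StarRing A] [CStarRing A]
    [NormedAlgebra ℂ A] [StarModule ℂ A] [FiniteDimensional ℂ A] : Type _ where
  W : WeakHopfData A
  /-- the Haar integral -/
  h : A
  haar_left : ∀ x : A, x * h = WeakHopfData.εL W x * h
  haar_right : ∀ x : A, h * x = h * WeakHopfData.εR W x
  haar_counitL : WeakHopfData.εL W h = 1
  haar_counitR : WeakHopfData.εR W h = 1
  haar_idem : h * h = h
  haar_star : star h = h
  haar_S : W.S h = h
  haar_nondeg : ∀ y : A, ∃ φ ψ : A →ₗ[ℂ] ℂ, lapp φ (W.Δ h) = y ∧ rapp ψ (W.Δ h) = y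
  /-- the Haar integral of the dual weak Hopf algebra `A*`, as a linear functional on `A` -/
  hHat : A →ₗ[ℂ] ℂ
  hHat_pos : ∀ x : A, ∃ r : ℝ, 0 ≤ r ∧ hHat (star x * x) = (r : ℂ)
  hHat_S : ∀ x : A, hHat (W.S x) = hHat x
  /-- `gL = (E^L h)^{1/2}` -/
  gL : A
  /-- `gR = (E^R h)^{1/2}` -/
  gR : A
  gL_pos : IsPosElem gL
  gR_pos : IsPosElem gR
  gL_unit : IsUnit gL
  gR_unit : IsUnit gR
  gL_sq : gL * gL = rapp hHat (W.Δ h)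
  gR_sq : gR * gR = lapp hHat (W.Δ h)
  gL_mem : gL ∈ Set.range (WeakHopfData.εL W)
  gR_mem : gR ∈ Set.range (WeakHopfData.εR W)
  gR_S : gR = W.S gL
  gLR_comm : gL * gR = gR * gL
  /-- the canonical grouplike element `g = gL * gR⁻¹` is positive -/
  g_pos : IsPosElem (gL * Ring.inverse gR)
  g_unit : IsUnit (gL * Ring.inverse gR)
  /-- `Δ g = (g ⊗ g) Δ 1` -/
  g_grouplike : W.Δ (gL * Ring.inverse gR)
      = ((gL * Ring.inverse gR) ⊗ₜ[ℂ] (gL * Ring.inverse gR)) * W.Δ 1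
  /-- `Δ g = Δ 1 (g ⊗ g)` -/
  g_grouplike' : W.Δ (gL * Ring.inverse gR)
      = W.Δ 1 * ((gL * Ring.inverse gR) ⊗ₜ[ℂ] (gL * Ring.inverse gR))
  /-- `S g = g⁻¹` -/
  g_S : W.S (gL * Ring.inverse gR) = Ring.inverse (gL * Ring.inverse gR)
  /-- `S² x = g x g⁻¹` -/
  S_sq : ∀ x : A,
      W.S (W.S x) = (gL * Ring.inverse gR) * x * Ring.inverse (gL * Ring.inverse gR)
  /-- `h₍₁₎ ⊗ g h₍₂₎ g = h₍₂₎ ⊗ h₍₁₎` -/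
  haar_flip : TensorProduct.map LinearMap.id
      (LinearMap.mulLeft ℂ (gL * Ring.inverse gR) ∘ₗ LinearMap.mulRight ℂ (gL * Ring.inverse gR))
      (W.Δ h) = (TensorProduct.comm ℂ A A) (W.Δ h)
  /-- dual integral relation `⟨ĥ, x (h gL⁻²)⟩ = ε x` -/
  hHat_dual₁ : ∀ x : A, hHat (x * (h * (Ring.inverse gL * Ring.inverse gL))) = W.ε x
  /-- dual integral relation `⟨ĥ, (gR⁻² h) x⟩ = ε x` -/
  hHat_dual₂ : ∀ x : A, hHat ((Ring.inverse gR * Ring.inverse gR * h) * x) = W.ε x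
  /-- dual integral relation `⟨ĥ, (h gL⁻²)₍₂₎⟩ (h gL⁻²)₍₁₎ = 1` -/
  hHat_dual₃ : rapp hHat (W.Δ (h * (Ring.inverse gL * Ring.inverse gL))) = 1
  /-- dual integral relation `⟨ĥ, (gR⁻² h)₍₁₎⟩ (gR⁻² h)₍₂₎ = 1` -/
  hHat_dual₄ : lapp hHat (W.Δ (Ring.inverse gR * Ring.inverse gR * h)) = 1
  /-- the positive square root, via the continuous functional calculus -/
  sqrt : A → A
  sqrt_pos : ∀ x : A, IsPosElem x → IsPosElem (sqrt x)
  sqrt_mul_self : ∀ x : A, IsPosElem x → sqrt x * sqrt x = x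
  /-- real powers of `gL`, via the continuous functional calculus -/
  gLpow : ℝ → A
  /-- real powers of `gR`, via the continuous functional calculus -/
  gRpow : ℝ → A
  gLpow_one : gLpow 1 = gL
  gRpow_one : gRpow 1 = gR
  gLpow_zero : gLpow 0 = 1
  gRpow_zero : gRpow 0 = 1
  gLpow_add : ∀ s t : ℝ, gLpow (s + t) = gLpow s * gLpow t
  gRpow_add : ∀ s t : ℝ, gRpow (s + t) = gRpow s * gRpow t
  gLpow_pos : ∀ t : ℝ, IsPosElem (gLpow t)
  gRpow_pos : ∀ t : ℝ, IsPosElem (gRpow t)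
  gLpow_continuous : Continuous gLpow
  gRpow_continuous : Continuous gRpow

namespace HaarPkg

variable {A : Type*} [NormedRing A] [StarRing A] [CStarRing A]
  [NormedAlgebra ℂ A] [StarModule ℂ A] [FiniteDimensional ℂ A]
variable (P : HaarPkg A)

/-- The canonical grouplike element `g = gL gR⁻¹`. -/
def g : A := P.gL * Ring.inverse P.gR

/-- The Watatani index `ı = ε^L (h gL⁻²)` of the Haar conditional expectations. -/
def iotaEl : A := WeakHopfData.εL P.W (P.h * (Ring.inverse P.gL * Ring.inverse P.gL))

/-- The element `ȷ = ⟨ĥ, (gL⁻²)₍₁₎⟩ (gL⁻²)₍₂₎`, the dual analogue of the Watatani index. -/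
def jayEl : A := lapp P.hHat (P.W.Δ (Ring.inverse P.gL * Ring.inverse P.gL))

/-- The pulling-through element `Ω = ı⁻¹ gL⁻¹ h gL⁻¹`. -/
def Ω : A := Ring.inverse P.iotaEl * Ring.inverse P.gL * P.h * Ring.inverse P.gL

/-- The map `J x = g^{-1/2} S(x) g^{1/2}`, as a linear map. -/
def Jlin : A →ₗ[ℂ] A :=
  LinearMap.mulRight ℂ (P.sqrt P.g) ∘ₗ
    LinearMap.mulLeft ℂ (Ring.inverse (P.sqrt P.g)) ∘ₗ P.W.S.toLinearMap

/-- The functional `⟨ω, x⟩ = ⟨ĥ, ȷ⁻¹ gL⁻¹ gR⁻¹ x⟩` (the dual analogue of `Ω`). -/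
def ω : A →ₗ[ℂ] ℂ :=
  P.hHat ∘ₗ LinearMap.mulLeft ℂ (Ring.inverse P.jayEl * (Ring.inverse P.gL * Ring.inverse P.gR))

/-- `ξ_L = ı^{1/2} ȷ^{1/2} gL`. -/
def ξL : A := P.sqrt P.iotaEl * P.sqrt P.jayEl * P.gL

/-- `ξ_R = ı^{1/2} ȷ^{1/2} gR`. -/
def ξR : A := P.sqrt P.iotaEl * P.sqrt P.jayEl * P.gR

/-- `ξ = ξ_L ξ_R`. -/
def ξ : A := P.ξL * P.ξR

/-- `J^L x = gL⁻¹ S(x) gL`. -/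
def JL : A → A := fun x => Ring.inverse P.gL * P.W.S x * P.gL

/-- `J^R x = gL S⁻¹(x) gL⁻¹`. -/
def JR : A → A := fun x => P.gL * P.W.S.symm x * Ring.inverse P.gL

end HaarPkg

namespace IsPosElem

section CStarAlgebra

variable {B : Type*} [CStarAlgebra B]

theorem isSelfAdjoint {a : B} (ha : IsPosElem a) : star a = a := by
  obtain ⟨y, rfl⟩ := ha
  simp

theorem mul_of_commute {a b : B} (ha : IsPosElem a) (hb : IsPosElem b) (hab : Commute a b) :
    IsPosElem (a * b) := by
  let := CStarAlgebra.spectralOrder B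
  have := CStarAlgebra.spectralOrderedRing B
  exact CStarAlgebra.nonneg_iff_eq_star_mul_self.mp <|
    hab.mul_nonneg (CStarAlgebra.nonneg_iff_eq_star_mul_self.mpr ha)
      (CStarAlgebra.nonneg_iff_eq_star_mul_self.mpr hb)

theorem isUnit_add {a b : B} (ha : IsPosElem a) (hb : IsPosElem b) (hu : IsUnit b) :
    IsUnit (a + b) := by
  let := CStarAlgebra.spectralOrder B
  have := CStarAlgebra.spectralOrderedRing B
  exact (IsStrictlyPositive.nonneg_add (CStarAlgebra.nonneg_iff_eq_star_mul_self.mpr ha)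
    (hu.isStrictlyPositive (CStarAlgebra.nonneg_iff_eq_star_mul_self.mpr hb))).isUnit

theorem mul_eq_of_mul_self_mul_eq {s r h : B} (hs : IsPosElem s) (hr : IsPosElem r)
    (hu : IsUnit r) (hc : Commute s r) (heq : s * s * h = r * r * h) : s * h = r * h := by
  refine (isUnit_add hs hr hu).mul_left_cancel ?_
  simp only [add_mul, ← mul_assoc, heq, hc.eq]
  abel

theorem commute_of_mul_self {s a x : B} (hs : IsPosElem s) (hsa : s * s = a)
    (hx : Commute a x) : Commute s x := by
  let := CStarAlgebra.spectralOrder B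
  have := CStarAlgebra.spectralOrderedRing B
  rw [← CFC.sqrt_unique hsa (CStarAlgebra.nonneg_iff_eq_star_mul_self.mpr hs)]
  exact hx.cfcₙ_nnreal _

theorem sum {n : Type*} [Fintype n] {a : n → B} (ha : ∀ i, IsPosElem (a i)) :
    IsPosElem (∑ i, a i) := by
  let := CStarAlgebra.spectralOrder B
  have := CStarAlgebra.spectralOrderedRing B
  exact CStarAlgebra.nonneg_iff_eq_star_mul_self.mp <|
    Finset.sum_nonneg fun i _ => CStarAlgebra.nonneg_iff_eq_star_mul_self.mpr (ha i)

theorem star_mul_eq_zero_of_sum_mul_eq_zero {n : Type*} [Fintype n] {e : n → B} {x : B}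
    (hx : (∑ i, e i * star (e i)) * x = 0) (i : n) : star (e i) * x = 0 := by
  let := CStarAlgebra.spectralOrder B
  have := CStarAlgebra.spectralOrderedRing B
  have hsum : ∑ i, star (star (e i) * x) * (star (e i) * x) = 0 := by
    calc _ = star x * ((∑ i, e i * star (e i)) * x) := by
          simp [Finset.mul_sum, Finset.sum_mul, mul_assoc]
      _ = 0 := by rw [hx, mul_zero]
  have := (Finset.sum_eq_zero_iff_of_nonneg fun i _ => star_mul_self_nonneg _).mp hsum i
    (Finset.mem_univ i)
  exact CStarRing.star_mul_self_eq_zero_iff _ |>.mp this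

end CStarAlgebra

end IsPosElem

/-- Orthonormal expansion with respect to an abstract inner product. -/
theorem InnerProductSpace.Core.exists_expansion {V : Type*} [AddCommGroup V] [Module ℂ V]
    [FiniteDimensional ℂ V] (c : InnerProductSpace.Core ℂ V) :
    ∃ (n : ℕ) (e : Fin n → V), ∀ y : V, y = ∑ i, c.inner (e i) y • e i := by
  let : NormedAddCommGroup V := c.toNormedAddCommGroup
  let : InnerProductSpace ℂ V := .ofCore c.toCore
  exact ⟨_, stdOrthonormalBasis ℂ V, fun y => ((stdOrthonormalBasis ℂ V).sum_repr' y).symm⟩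

section Contractions

variable {A : Type*} [NormedRing A] [NormedAlgebra ℂ A]

@[simp] theorem lapp_tmul (φ : A →ₗ[ℂ] ℂ) (a b : A) : lapp φ (a ⊗ₜ[ℂ] b) = φ a • b := by
  simp [lapp]

@[simp] theorem rapp_tmul (φ : A →ₗ[ℂ] ℂ) (a b : A) : rapp φ (a ⊗ₜ[ℂ] b) = φ b • a := by
  simp [rapp]

theorem lapp_one_tmul_mul (φ : A →ₗ[ℂ] ℂ) (e : A) (u : A ⊗[ℂ] A) :
    lapp φ (((1 : A) ⊗ₜ[ℂ] e) * u) = e * lapp φ u := by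
  induction u with
  | zero => simp
  | tmul a b => simp
  | add u v hu hv => simp only [mul_add, map_add, hu, hv]

theorem lapp_mul_one_tmul (φ : A →ₗ[ℂ] ℂ) (e : A) (u : A ⊗[ℂ] A) :
    lapp φ (u * ((1 : A) ⊗ₜ[ℂ] e)) = lapp φ u * e := by
  induction u with
  | zero => simp
  | tmul a b => simp
  | add u v hu hv => simp only [add_mul, map_add, hu, hv]

theorem lapp_tmul_one_mul_mul (φ : A →ₗ[ℂ] ℂ) (a b : A) (u : A ⊗[ℂ] A) :
    lapp φ ((a ⊗ₜ[ℂ] (1 : A)) * u * (b ⊗ₜ[ℂ] (1 : A))) =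
      lapp (φ ∘ₗ LinearMap.mulLeft ℂ a ∘ₗ LinearMap.mulRight ℂ b) u := by
  induction u with
  | zero => simp
  | tmul c d => simp [mul_assoc]
  | add u v hu hv => simp only [mul_add, add_mul, map_add, hu, hv]

theorem rapp_tmul_one_mul_mul (φ : A →ₗ[ℂ] ℂ) (a b : A) (u : A ⊗[ℂ] A) :
    rapp φ ((a ⊗ₜ[ℂ] (1 : A)) * u * (b ⊗ₜ[ℂ] (1 : A))) = a * rapp φ u * b := by
  induction u with
  | zero => simp
  | tmul c d => simp
  | add u v hu hv => simp only [mul_add, add_mul, map_add, hu, hv]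

end Contractions

namespace WeakHopfData

variable {A : Type*} [NormedRing A] [StarRing A] [CStarRing A]
  [NormedAlgebra ℂ A] [StarModule ℂ A] [FiniteDimensional ℂ A] (W : WeakHopfData A)

theorem S_one : W.S 1 = 1 := by
  obtain ⟨y, hy⟩ := W.S.surjective 1
  have := W.S_antimul y 1
  rwa [mul_one, hy, mul_one, eq_comm] at this

theorem rapp_ε_Δ (x : A) : rapp W.ε (W.Δ x) = x := LinearMap.congr_fun W.counit_right x

theorem lapp_ε_Δ (x : A) : lapp W.ε (W.Δ x) = x := LinearMap.congr_fun W.counit_left x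

theorem Δ_one_mul (x : A) : W.Δ 1 * W.Δ x = W.Δ x := by rw [← W.Δ_mul, one_mul]

theorem Δ_mul_one (x : A) : W.Δ x * W.Δ 1 = W.Δ x := by rw [← W.Δ_mul, mul_one]

/-- The map `u₁ ⊗ u₂ ↦ S(u₂) ⊗ S(u₁)`. -/
def flipS : A ⊗[ℂ] A →ₗ[ℂ] A ⊗[ℂ] A :=
  (TensorProduct.comm ℂ A A).toLinearMap ∘ₗ
    TensorProduct.map W.S.toLinearMap W.S.toLinearMap

@[simp] theorem flipS_tmul (a b : A) : W.flipS (a ⊗ₜ[ℂ] b) = W.S b ⊗ₜ[ℂ] W.S a := by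
  simp [flipS]

theorem Δ_S (x : A) : W.Δ (W.S x) = W.flipS (W.Δ x) := W.S_anticomul x

theorem flipS_mul (u v : A ⊗[ℂ] A) : W.flipS (u * v) = W.flipS v * W.flipS u := by
  induction u with
  | zero => simp
  | add u u' hu hu' => simp only [add_mul, mul_add, map_add, hu, hu']
  | tmul a b =>
    induction v with
    | zero => simp
    | add v v' hv hv' => simp only [add_mul, mul_add, map_add, hv, hv']
    | tmul c d => simp [W.S_antimul]

/-- The map `u₁ ⊗ u₂ ↦ u₁ S(u₂)`. -/
def mulIdS : A ⊗[ℂ] A →ₗ[ℂ] A :=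
  LinearMap.mul' ℂ A ∘ₗ TensorProduct.map LinearMap.id W.S.toLinearMap

/-- The map `u₁ ⊗ u₂ ↦ S(u₁) u₂`. -/
def mulSId : A ⊗[ℂ] A →ₗ[ℂ] A :=
  LinearMap.mul' ℂ A ∘ₗ TensorProduct.map W.S.toLinearMap LinearMap.id

@[simp] theorem mulIdS_tmul (a b : A) : W.mulIdS (a ⊗ₜ[ℂ] b) = a * W.S b := by simp [mulIdS]

@[simp] theorem mulSId_tmul (a b : A) : W.mulSId (a ⊗ₜ[ℂ] b) = W.S a * b := by simp [mulSId]

theorem εL_apply (x : A) : W.εL x = W.mulIdS (W.Δ x) := rfl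

theorem εR_apply (x : A) : W.εR x = W.mulSId (W.Δ x) := rfl

theorem εL_eq_lapp (x : A) : W.εL x = lapp (W.ε ∘ₗ LinearMap.mulRight ℂ x) (W.Δ 1) :=
  W.antipode_left x

theorem mulIdS_tmul_one_mul (a : A) (u : A ⊗[ℂ] A) :
    W.mulIdS ((a ⊗ₜ[ℂ] (1 : A)) * u) = a * W.mulIdS u := by
  induction u with
  | zero => simp
  | tmul c d => simp [mul_assoc]
  | add u v hu hv => simp only [mul_add, map_add, hu, hv]

theorem mulIdS_one_tmul_mul (a : A) (u : A ⊗[ℂ] A) :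
    W.mulIdS (((1 : A) ⊗ₜ[ℂ] a) * u) = W.mulIdS u * W.S a := by
  induction u with
  | zero => simp
  | tmul c d => simp [W.S_antimul, mul_assoc]
  | add u v hu hv => simp only [mul_add, add_mul, map_add, hu, hv]

theorem mulSId_mul_tmul_one (a : A) (u : A ⊗[ℂ] A) :
    W.mulSId (u * (a ⊗ₜ[ℂ] (1 : A))) = W.S a * W.mulSId u := by
  induction u with
  | zero => simp
  | tmul c d => simp [W.S_antimul, mul_assoc]
  | add u v hu hv => simp only [mul_add, add_mul, map_add, hu, hv]

theorem S_mulIdS (u : A ⊗[ℂ] A) : W.S (W.mulIdS u) = W.mulSId (W.flipS u) := by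
  induction u with
  | zero => simp
  | tmul c d => simp [W.S_antimul]
  | add u v hu hv => simp only [map_add, hu, hv]

theorem εR_S (x : A) : W.εR (W.S x) = W.S (W.εL x) := by
  rw [εR_apply, εL_apply, S_mulIdS, Δ_S]

theorem εL_one : W.εL 1 = 1 := by
  rw [εL_eq_lapp, LinearMap.mulRight_one, LinearMap.comp_id, lapp_ε_Δ]

theorem εR_one : W.εR 1 = 1 := by
  simpa [S_one, εL_one] using W.εR_S 1

theorem sum_Δ_tmul {s : Finset (A × A)} (hs : W.Δ 1 = ∑ p ∈ s, p.1 ⊗ₜ[ℂ] p.2) :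
    ∑ p ∈ s, W.Δ p.1 ⊗ₜ[ℂ] p.2 =
      ∑ p ∈ s, (W.Δ 1 * ((1 : A) ⊗ₜ[ℂ] p.1)) ⊗ₜ[ℂ] p.2 := by
  have h := W.Δ_one_weak
  have h1 : (TensorProduct.assoc ℂ A A A).symm ((1 : A) ⊗ₜ[ℂ] W.Δ 1) =
      ∑ p ∈ s, ((1 : A) ⊗ₜ[ℂ] p.1) ⊗ₜ[ℂ] p.2 := by
    rw [hs]; simp [TensorProduct.tmul_sum]
  rw [h1] at h
  conv at h => lhs; rw [hs]
  simpa [Finset.mul_sum] using h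

theorem sum_Δ_tmul' {s : Finset (A × A)} (hs : W.Δ 1 = ∑ p ∈ s, p.1 ⊗ₜ[ℂ] p.2) :
    ∑ p ∈ s, W.Δ p.1 ⊗ₜ[ℂ] p.2 =
      ∑ p ∈ s, (((1 : A) ⊗ₜ[ℂ] p.1) * W.Δ 1) ⊗ₜ[ℂ] p.2 := by
  have h := W.Δ_one_weak'
  have h1 : (TensorProduct.assoc ℂ A A A).symm ((1 : A) ⊗ₜ[ℂ] W.Δ 1) =
      ∑ p ∈ s, ((1 : A) ⊗ₜ[ℂ] p.1) ⊗ₜ[ℂ] p.2 := by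
    rw [hs]; simp [TensorProduct.tmul_sum]
  rw [h1] at h
  conv at h => lhs; rw [hs]
  simpa [Finset.sum_mul] using h

/-- `x₍₁₎ ⊗ ε^L(x₍₂₎) = 1₍₁₎ x ⊗ 1₍₂₎`. -/
theorem map_id_εL_Δ (x : A) :
    TensorProduct.map LinearMap.id W.εL (W.Δ x) = W.Δ 1 * (x ⊗ₜ[ℂ] (1 : A)) := by
  obtain ⟨s, hs⟩ := TensorProduct.exists_finset (W.Δ 1)
  have key (u : A ⊗[ℂ] A) : TensorProduct.map LinearMap.id W.εL u =
      ∑ p ∈ s, rapp W.ε (((1 : A) ⊗ₜ[ℂ] p.1) * u) ⊗ₜ[ℂ] p.2 := by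
    induction u with
    | zero => simp
    | tmul a b => simp [εL_eq_lapp, hs, TensorProduct.tmul_sum, TensorProduct.smul_tmul]
    | add u v hu hv =>
      simp only [mul_add, map_add, hu, hv, TensorProduct.add_tmul, Finset.sum_add_distrib]
  have h := congrArg (TensorProduct.map (rapp W.ε ∘ₗ LinearMap.mulRight ℂ (W.Δ x))
    (LinearMap.id : A →ₗ[ℂ] A)) (W.sum_Δ_tmul' hs)
  simp only [map_sum, TensorProduct.map_tmul, LinearMap.comp_apply, LinearMap.mulRight_apply,
    LinearMap.id_apply, mul_assoc, ← W.Δ_mul, one_mul, rapp_ε_Δ] at h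
  rw [key, ← h, hs, Finset.sum_mul]
  simp

/-- `ε^R(x₍₁₎) ⊗ x₍₂₎ = 1₍₁₎ ⊗ x 1₍₂₎`. -/
theorem map_εR_id_Δ (x : A) :
    TensorProduct.map W.εR LinearMap.id (W.Δ x) = ((1 : A) ⊗ₜ[ℂ] x) * W.Δ 1 := by
  obtain ⟨x, rfl⟩ := W.S.surjective x
  have key (u : A ⊗[ℂ] A) : TensorProduct.map W.εR LinearMap.id (W.flipS u) =
      W.flipS (TensorProduct.map LinearMap.id W.εL u) := by
    induction u with
    | zero => simp
    | tmul a b => simp [εR_S]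
    | add u v hu hv => simp only [map_add, hu, hv]
  rw [Δ_S, key, map_id_εL_Δ, flipS_mul, ← Δ_S, flipS_tmul, S_one]

theorem S_mul_εL (x : A) :
    LinearMap.mul' ℂ A (TensorProduct.map W.S.toLinearMap W.εL (W.Δ x)) = W.S x := by
  have h := congrArg W.mulSId (W.map_id_εL_Δ x)
  rw [mulSId_mul_tmul_one, ← εR_apply, εR_one, mul_one] at h
  rw [← h, mulSId, LinearMap.comp_apply, TensorProduct.map_map]
  rfl

/-- Multiplication by `z` acts on the first leg of every coproduct. -/
def ActsOnLeftLeg (z : A) : Prop :=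
  ∀ x, W.Δ (z * x) = (z ⊗ₜ[ℂ] (1 : A)) * W.Δ x ∧ W.Δ (x * z) = W.Δ x * (z ⊗ₜ[ℂ] (1 : A))

/-- Multiplication by `z` acts on the second leg of every coproduct. -/
def ActsOnRightLeg (z : A) : Prop :=
  ∀ x, W.Δ (z * x) = ((1 : A) ⊗ₜ[ℂ] z) * W.Δ x ∧ W.Δ (x * z) = W.Δ x * ((1 : A) ⊗ₜ[ℂ] z)

theorem Δ_lapp_Δ_one (φ : A →ₗ[ℂ] ℂ) {s : Finset (A × A)}
    (hs : W.Δ 1 = ∑ p ∈ s, p.1 ⊗ₜ[ℂ] p.2) :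
    W.Δ (lapp φ (W.Δ 1)) = ∑ p ∈ s, lapp φ (W.Δ p.1) ⊗ₜ[ℂ] p.2 := by
  have hassoc (u : (A ⊗[ℂ] A) ⊗[ℂ] A) :
      TensorProduct.lid ℂ (A ⊗[ℂ] A) (TensorProduct.map φ LinearMap.id
        (TensorProduct.assoc ℂ A A A u)) = TensorProduct.map (lapp φ) LinearMap.id u := by
    refine LinearMap.congr_fun (f := (TensorProduct.lid ℂ (A ⊗[ℂ] A)).toLinearMap ∘ₗ
      TensorProduct.map φ LinearMap.id ∘ₗ (TensorProduct.assoc ℂ A A A).toLinearMap) ?_ u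
    ext a b c
    simp [TensorProduct.smul_tmul']
  have h := LinearMap.congr_fun W.coassoc 1
  simp only [LinearMap.comp_apply, LinearEquiv.coe_coe] at h
  have h' := hassoc (TensorProduct.map W.Δ LinearMap.id (W.Δ 1))
  rw [h] at h'
  calc W.Δ (lapp φ (W.Δ 1)) = TensorProduct.lid ℂ (A ⊗[ℂ] A) (TensorProduct.map φ LinearMap.id
        (TensorProduct.map LinearMap.id W.Δ (W.Δ 1))) := by rw [hs]; simp
    _ = _ := by rw [h', hs]; simp

theorem actsOnLeftLeg_εL (y : A) : W.ActsOnLeftLeg (W.εL y) := by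
  obtain ⟨s, hs⟩ := TensorProduct.exists_finset (W.Δ 1)
  have h (T : A ⊗[ℂ] A →ₗ[ℂ] A) := congrArg (TensorProduct.map T (LinearMap.id : A →ₗ[ℂ] A))
    (W.sum_Δ_tmul hs)
  have h' (T : A ⊗[ℂ] A →ₗ[ℂ] A) := congrArg (TensorProduct.map T (LinearMap.id : A →ₗ[ℂ] A))
    (W.sum_Δ_tmul' hs)
  simp only [map_sum, TensorProduct.map_tmul, LinearMap.id_apply] at h h'
  set φ := W.ε ∘ₗ LinearMap.mulRight ℂ y
  have h1 : W.Δ (W.εL y) = (W.εL y ⊗ₜ[ℂ] (1 : A)) * W.Δ 1 := by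
    rw [εL_eq_lapp, Δ_lapp_Δ_one W _ hs, h]
    simp only [lapp_mul_one_tmul]
    conv_rhs => rw [hs, Finset.mul_sum]
    simp [← hs]
  have h2 : W.Δ (W.εL y) = W.Δ 1 * (W.εL y ⊗ₜ[ℂ] (1 : A)) := by
    rw [εL_eq_lapp, Δ_lapp_Δ_one W _ hs, h']
    simp only [lapp_one_tmul_mul]
    conv_rhs => rw [hs, Finset.sum_mul]
    simp [← hs]
  refine fun x => ⟨?_, ?_⟩
  · rw [W.Δ_mul, h1, mul_assoc, Δ_one_mul]
  · rw [W.Δ_mul, h2, ← mul_assoc, Δ_mul_one]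

variable {W}

theorem ActsOnLeftLeg.actsOnRightLeg_S {z : A} (hz : W.ActsOnLeftLeg z) :
    W.ActsOnRightLeg (W.S z) := by
  intro x
  obtain ⟨x, rfl⟩ := W.S.surjective x
  constructor
  · rw [← W.S_antimul, Δ_S, (hz x).2, flipS_mul, Δ_S, flipS_tmul, S_one]
  · rw [← W.S_antimul, Δ_S, (hz x).1, flipS_mul, Δ_S, flipS_tmul, S_one]

theorem ActsOnLeftLeg.mul {z w : A} (hz : W.ActsOnLeftLeg z) (hw : W.ActsOnLeftLeg w) :
    W.ActsOnLeftLeg (z * w) := by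
  intro x
  rw [mul_assoc, (hz _).1, (hw _).1, ← mul_assoc x, (hw _).2, (hz _).2]
  simp [← mul_assoc]
  simp [mul_assoc]

theorem ActsOnLeftLeg.inverse {z : A} (hz : W.ActsOnLeftLeg z) (hu : IsUnit z) :
    W.ActsOnLeftLeg (Ring.inverse z) := by
  have h1 := Ring.mul_inverse_cancel z hu
  have h2 := Ring.inverse_mul_cancel z hu
  intro x
  constructor
  · have h := (hz (Ring.inverse z * x)).1
    rw [← mul_assoc, h1, one_mul] at h
    rw [h, ← mul_assoc, Algebra.TensorProduct.tmul_mul_tmul, h2, one_mul]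
    exact (one_mul _).symm
  · have h := (hz (x * Ring.inverse z)).2
    rw [mul_assoc, h2, mul_one] at h
    rw [h, mul_assoc, Algebra.TensorProduct.tmul_mul_tmul, h1, one_mul]
    exact (mul_one _).symm

theorem ActsOnLeftLeg.εR_eq {z : A} (hz : W.ActsOnLeftLeg z) : W.εR z = W.S z := by
  rw [εR_apply, ← one_mul z, (hz 1).2, mulSId_mul_tmul_one, ← εR_apply, εR_one, one_mul, mul_one]

theorem ActsOnRightLeg.εL_eq {z : A} (hz : W.ActsOnRightLeg z) : W.εL z = W.S z := by
  rw [εL_apply, ← mul_one z, (hz 1).1, mulIdS_one_tmul_mul, ← εL_apply, εL_one, one_mul, mul_one]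

/-- `S(x) l₍₁₎ ⊗ l₍₂₎ = l₍₁₎ ⊗ x l₍₂₎` for every left integral `l`. -/
theorem S_tmul_one_mul_Δ {l : A} (hl : ∀ x, x * l = W.εL x * l) (x : A) :
    (W.S x ⊗ₜ[ℂ] (1 : A)) * W.Δ l = ((1 : A) ⊗ₜ[ℂ] x) * W.Δ l := by
  let K : A ⊗[ℂ] (A ⊗[ℂ] A) →ₗ[ℂ] A ⊗[ℂ] A :=
    TensorProduct.lift ((LinearMap.mul ℂ (A ⊗[ℂ] A)).compl₁₂
      ((TensorProduct.mk ℂ A A).flip 1 ∘ₗ W.S.toLinearMap) (LinearMap.mulRight ℂ (W.Δ l)))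
  have hK (a : A) (p : A ⊗[ℂ] A) :
      K (a ⊗ₜ[ℂ] p) = (W.S a ⊗ₜ[ℂ] (1 : A)) * (p * W.Δ l) := by simp [K]
  have h1 (u : A ⊗[ℂ] A) : K (TensorProduct.map LinearMap.id W.Δ u) =
      (LinearMap.mul' ℂ A (TensorProduct.map W.S.toLinearMap W.εL u) ⊗ₜ[ℂ] (1 : A)) *
        W.Δ l := by
    induction u with
    | zero => simp
    | tmul a b =>
      rw [TensorProduct.map_tmul, hK, ← W.Δ_mul, hl, (W.actsOnLeftLeg_εL b l).1, ← mul_assoc]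
      simp
    | add u v hu hv => simp only [map_add, hu, hv, TensorProduct.add_tmul, add_mul]
  have h2 (p : A ⊗[ℂ] A) (c : A) : K (TensorProduct.assoc ℂ A A A (p ⊗ₜ[ℂ] c)) =
      (W.mulSId p ⊗ₜ[ℂ] c) * W.Δ l := by
    induction p with
    | zero => simp
    | tmul a b => simp [hK, ← mul_assoc]
    | add u v hu hv => simp only [map_add, hu, hv, TensorProduct.add_tmul, add_mul]
  have h3 (u : A ⊗[ℂ] A) :
      K (TensorProduct.assoc ℂ A A A (TensorProduct.map W.Δ LinearMap.id u)) =
        TensorProduct.map W.εR LinearMap.id u * W.Δ l := by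
    induction u with
    | zero => simp
    | tmul a b => simp [h2, εR_apply]
    | add u v hu hv => simp only [map_add, hu, hv, add_mul]
  have h := LinearMap.congr_fun W.coassoc x
  simp only [LinearMap.comp_apply, LinearEquiv.coe_coe] at h
  rw [← W.S_mul_εL x, ← h1, ← h, h3, map_εR_id_Δ, mul_assoc, Δ_one_mul]

end WeakHopfData

/-- A finite-dimensional normed star algebra with the `C⋆`-identity is a `C⋆`-algebra. -/
@[reducible] def cstarAlgebraOfFiniteDimensional (A : Type*) [NormedRing A] [StarRing A]
    [CStarRing A] [NormedAlgebra ℂ A] [StarModule ℂ A] [FiniteDimensional ℂ A] :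
    CStarAlgebra A where
  complete := (FiniteDimensional.complete ℂ A).complete

section Cancellation

variable {R : Type*} [Ring R] {a b x : R}

theorem ringInverse_mul_eq_of_mul_eq (ha : IsUnit a) (hb : IsUnit b) (hab : Commute a b)
    (h : a * x = b * x) : Ring.inverse a * x = Ring.inverse b * x := by
  obtain ⟨a, rfl⟩ := ha
  obtain ⟨b, rfl⟩ := hb
  rw [Ring.inverse_unit, Ring.inverse_unit, Units.inv_mul_eq_iff_eq_mul, ← mul_assoc,
    (hab.symm.units_inv_left.eq).symm, mul_assoc, h, Units.inv_mul_cancel_left]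

theorem mul_ringInverse_eq_of_mul_eq (ha : IsUnit a) (hb : IsUnit b) (hab : Commute a b)
    (h : x * a = x * b) : x * Ring.inverse a = x * Ring.inverse b := by
  obtain ⟨a, rfl⟩ := ha
  obtain ⟨b, rfl⟩ := hb
  rw [Ring.inverse_unit, Ring.inverse_unit, Units.mul_inv_eq_iff_eq_mul, mul_assoc,
    hab.symm.units_inv_left.eq, ← mul_assoc, h, Units.mul_inv_cancel_right]

theorem ringInverse_mul_eq_self (ha : IsUnit a) (h : a * x = x) : Ring.inverse a * x = x := by
  conv_lhs => rw [← h]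
  exact Ring.inverse_mul_cancel_left a x ha

end Cancellation

namespace HaarPkg

variable {A : Type*} [NormedRing A] [StarRing A] [CStarRing A]
  [NormedAlgebra ℂ A] [StarModule ℂ A] [FiniteDimensional ℂ A] (P : HaarPkg A)

theorem gL_mul_inverse : P.gL * Ring.inverse P.gL = 1 := Ring.mul_inverse_cancel _ P.gL_unit

theorem inverse_mul_gL : Ring.inverse P.gL * P.gL = 1 := Ring.inverse_mul_cancel _ P.gL_unit

theorem gR_mul_inverse : P.gR * Ring.inverse P.gR = 1 := Ring.mul_inverse_cancel _ P.gR_unit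

theorem commute_inverse_gL_inverse_gR : Commute (Ring.inverse P.gL) (Ring.inverse P.gR) :=
  Commute.ringInverse_ringInverse (show Commute P.gL P.gR from P.gLR_comm)

theorem commute_gL_inverse_gR : Commute P.gL (Ring.inverse P.gR) := by
  have h : P.gL * P.gR = P.gR * P.gL := P.gLR_comm
  obtain ⟨u, hu⟩ := P.gR_unit
  rw [← hu] at h ⊢
  rw [Ring.inverse_unit]
  exact Commute.units_inv_right h

theorem isUnit_g : IsUnit P.g := P.g_unit

theorem isPosElem_g : IsPosElem P.g := P.g_pos

theorem commute_gL_g : Commute P.gL P.g :=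
  (Commute.refl _).mul_right P.commute_gL_inverse_gR

theorem S_gR : P.W.S P.gR = P.gL := by
  have h : P.W.S (P.W.S P.gL) = P.g * P.gL * Ring.inverse P.g := P.S_sq P.gL
  rw [← P.gR_S, ← P.commute_gL_g.eq, mul_assoc, Ring.mul_inverse_cancel _ P.isUnit_g, mul_one] at h
  exact h

theorem S_inverse {a : A} (ha : IsUnit a) :
    P.W.S (Ring.inverse a) = Ring.inverse (P.W.S a) := by
  have h1 : P.W.S (Ring.inverse a) * P.W.S a = 1 := by
    rw [← P.W.S_antimul, Ring.mul_inverse_cancel _ ha, P.W.S_one]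
  have h2 : P.W.S a * P.W.S (Ring.inverse a) = 1 := by
    rw [← P.W.S_antimul, Ring.inverse_mul_cancel _ ha, P.W.S_one]
  exact (Ring.inverse_unit ⟨_, _, h2, h1⟩).symm

theorem S_inverse_gL : P.W.S (Ring.inverse P.gL) = Ring.inverse P.gR := by
  rw [P.S_inverse P.gL_unit, P.gR_S]

theorem actsOnLeftLeg_gL : P.W.ActsOnLeftLeg P.gL := by
  obtain ⟨y, hy⟩ := P.gL_mem
  exact hy ▸ P.W.actsOnLeftLeg_εL y

theorem actsOnLeftLeg_inverse_gL : P.W.ActsOnLeftLeg (Ring.inverse P.gL) :=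
  P.actsOnLeftLeg_gL.inverse P.gL_unit

theorem actsOnRightLeg_inverse_gR : P.W.ActsOnRightLeg (Ring.inverse P.gR) :=
  P.S_inverse_gL ▸ P.actsOnLeftLeg_inverse_gL.actsOnRightLeg_S

theorem gL_mul_h : P.gL * P.h = P.gR * P.h := by
  have h : P.W.ActsOnRightLeg P.gR := P.gR_S ▸ P.actsOnLeftLeg_gL.actsOnRightLeg_S
  rw [P.haar_left P.gR, h.εL_eq, S_gR]

theorem h_mul_gL : P.h * P.gL = P.h * P.gR := by
  rw [P.haar_right P.gL, P.actsOnLeftLeg_gL.εR_eq, P.gR_S]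

theorem inverse_gL_mul_h : Ring.inverse P.gL * P.h = Ring.inverse P.gR * P.h :=
  ringInverse_mul_eq_of_mul_eq P.gL_unit P.gR_unit P.gLR_comm P.gL_mul_h

theorem h_mul_inverse_gL : P.h * Ring.inverse P.gL = P.h * Ring.inverse P.gR :=
  mul_ringInverse_eq_of_mul_eq P.gL_unit P.gR_unit P.gLR_comm P.h_mul_gL

theorem Δ_h_mul_inverse_gL_sq :
    P.W.Δ (P.h * (Ring.inverse P.gL * Ring.inverse P.gL)) =
      P.W.Δ P.h * ((Ring.inverse P.gL * Ring.inverse P.gL) ⊗ₜ[ℂ] (1 : A)) :=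
  ((P.actsOnLeftLeg_inverse_gL.mul P.actsOnLeftLeg_inverse_gL) P.h).2

theorem Δ_h_mul_inverse_gL_sq' :
    P.W.Δ (P.h * (Ring.inverse P.gL * Ring.inverse P.gL)) =
      P.W.Δ P.h * ((1 : A) ⊗ₜ[ℂ] (Ring.inverse P.gR * Ring.inverse P.gR)) := by
  rw [← mul_assoc, h_mul_inverse_gL, mul_assoc, ← P.commute_inverse_gL_inverse_gR.eq, ← mul_assoc,
    h_mul_inverse_gL, (P.actsOnRightLeg_inverse_gR _).2, (P.actsOnRightLeg_inverse_gR _).2,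
    mul_assoc, Algebra.TensorProduct.tmul_mul_tmul, one_mul]

theorem iotaEl_eq_mulIdS : P.iotaEl =
    P.W.mulIdS (P.W.Δ P.h * ((Ring.inverse P.gL * Ring.inverse P.gL) ⊗ₜ[ℂ] (1 : A))) := by
  rw [← Δ_h_mul_inverse_gL_sq]
  rfl

theorem actsOnLeftLeg_iotaEl : P.W.ActsOnLeftLeg P.iotaEl := P.W.actsOnLeftLeg_εL _

theorem commute_iotaEl (x : A) : Commute P.iotaEl x := by
  obtain ⟨y, rfl⟩ := P.W.S.surjective x
  rw [commute_iff_eq, iotaEl_eq_mulIdS, ← P.W.mulIdS_tmul_one_mul, ← P.W.mulIdS_one_tmul_mul,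
    ← mul_assoc, ← mul_assoc, P.W.S_tmul_one_mul_Δ P.haar_left]

theorem S_iotaEl : P.W.S P.iotaEl = P.iotaEl := by
  set k := Ring.inverse P.gL * Ring.inverse P.gL with hk
  have hSk : P.W.S k = Ring.inverse P.gR * Ring.inverse P.gR := by
    rw [hk, P.W.S_antimul, S_inverse_gL]
  have hΔ : P.W.flipS (P.W.Δ P.h) = P.W.Δ P.h := by rw [← P.W.Δ_S, P.haar_S]
  have hflip : TensorProduct.map LinearMap.id
      (LinearMap.mulLeft ℂ P.g ∘ₗ LinearMap.mulRight ℂ P.g) (P.W.Δ P.h) =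
      TensorProduct.map P.W.S.toLinearMap P.W.S.toLinearMap (P.W.Δ P.h) := by
    refine P.haar_flip.trans ?_
    conv_lhs => rw [← hΔ]
    exact (TensorProduct.comm ℂ A A).symm_apply_apply _
  have hgg : k * P.g * P.g = P.W.S k := by
    rw [hSk, hk, g]
    calc _ = Ring.inverse P.gL * (Ring.inverse P.gL * P.gL) *
          (Ring.inverse P.gR * P.gL) * Ring.inverse P.gR := by simp only [mul_assoc]
      _ = _ := by
        rw [← P.commute_gL_inverse_gR.eq, inverse_mul_gL, mul_one, ← mul_assoc, inverse_mul_gL,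
          one_mul]
  have hginv : P.W.S (Ring.inverse P.g) = P.g := by
    have h : P.W.S P.g = Ring.inverse P.g := P.g_S
    rw [P.S_inverse P.isUnit_g, h, Ring.inverse_inverse P.isUnit_g]
  have hS (b : A) : P.W.S k * P.W.S.symm (P.g * b * P.g) = k * P.W.S b := by
    obtain ⟨c, hc⟩ := P.W.S.surjective (P.g * b * P.g)
    have hb : b = Ring.inverse P.g * P.W.S c * Ring.inverse P.g := by
      rw [hc, mul_assoc P.g, Ring.inverse_mul_cancel_left _ _ P.isUnit_g,
        Ring.mul_inverse_cancel_right _ _ P.isUnit_g]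
    have hSS : P.W.S (P.W.S c) = P.g * c * Ring.inverse P.g := P.S_sq c
    have hSb : P.W.S b = P.g * (P.g * c) := by
      rw [hb, P.W.S_antimul, P.W.S_antimul, hginv, hSS,
        Ring.inverse_mul_cancel_right _ _ P.isUnit_g]
    rw [← hc, LinearEquiv.symm_apply_apply, hSb, ← hgg]
    simp only [mul_assoc]
  let G : A ⊗[ℂ] A →ₗ[ℂ] A := LinearMap.mul' ℂ A ∘ₗ
    TensorProduct.map (LinearMap.mulRight ℂ (P.W.S k)) P.W.S.symm.toLinearMap
  have hG1 (u : A ⊗[ℂ] A) : G (TensorProduct.map P.W.S.toLinearMap P.W.S.toLinearMap u) =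
      P.W.mulSId (((1 : A) ⊗ₜ[ℂ] P.W.S k) * u) := by
    induction u with
    | zero => simp
    | tmul a b => simp [G, mul_assoc]
    | add u v hu hv => simp only [map_add, hu, hv, mul_add]
  have hG2 (u : A ⊗[ℂ] A) : G (TensorProduct.map LinearMap.id
      (LinearMap.mulLeft ℂ P.g ∘ₗ LinearMap.mulRight ℂ P.g) u) =
      P.W.mulIdS (u * (k ⊗ₜ[ℂ] (1 : A))) := by
    induction u with
    | zero => simp
    | tmul a b => simp [G, mul_assoc, ← hS]
    | add u v hu hv => simp only [map_add, hu, hv, add_mul]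
  rw [iotaEl_eq_mulIdS, P.W.S_mulIdS, P.W.flipS_mul, hΔ, P.W.flipS_tmul, P.W.S_one, ← hG1,
    ← hflip, hG2]

theorem lapp_hHat_dual (x : A) : lapp P.hHat ((x ⊗ₜ[ℂ] (1 : A)) *
    TensorProduct.map LinearMap.id P.W.S.toLinearMap
      (P.W.Δ (P.h * (Ring.inverse P.gL * Ring.inverse P.gL)))) = x := by
  obtain ⟨y, rfl⟩ := P.W.S.surjective x
  have h1 (u : A ⊗[ℂ] A) : (P.W.S y ⊗ₜ[ℂ] (1 : A)) *
      TensorProduct.map LinearMap.id P.W.S.toLinearMap u =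
      TensorProduct.map LinearMap.id P.W.S.toLinearMap ((P.W.S y ⊗ₜ[ℂ] (1 : A)) * u) := by
    induction u with
    | zero => simp
    | tmul a b => simp
    | add u v hu hv => simp only [map_add, hu, hv, mul_add]
  have h2 (u : A ⊗[ℂ] A) : lapp P.hHat (TensorProduct.map LinearMap.id P.W.S.toLinearMap u) =
      P.W.S (lapp P.hHat u) := by
    induction u with
    | zero => simp
    | tmul a b => simp
    | add u v hu hv => simp only [map_add, hu, hv]
  rw [h1, h2, Δ_h_mul_inverse_gL_sq', ← mul_assoc, P.W.S_tmul_one_mul_Δ P.haar_left,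
    lapp_mul_one_tmul, lapp_one_tmul_mul, ← P.gR_sq, mul_assoc, mul_assoc P.gR,
    ← mul_assoc P.gR (Ring.inverse P.gR), gR_mul_inverse, one_mul, gR_mul_inverse, mul_one]

theorem conj_hHat_star_mul (x y : A) :
    starRingEnd ℂ (P.hHat (star y * x)) = P.hHat (star x * y) := by
  obtain ⟨a, -, ha⟩ := P.hHat_pos x
  obtain ⟨b, -, hb⟩ := P.hHat_pos y
  obtain ⟨c, -, hc⟩ := P.hHat_pos (x + y)
  obtain ⟨d, -, hd⟩ := P.hHat_pos (x + Complex.I • y)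
  simp only [star_add, star_smul, add_mul, mul_add, smul_mul_assoc, mul_smul_comm, map_add,
    map_smul, ha, hb, smul_eq_mul, Complex.star_def, Complex.conj_I] at hc hd
  have hc' := congrArg Complex.im hc
  have hd' := congrArg Complex.im hd
  simp at hc' hd'
  apply Complex.ext <;> simp <;> linarith

/-- The positive semidefinite sesquilinear form `(x, y) ↦ ⟨ĥ, x* y⟩`. -/
@[reducible] def hHatPreCore : PreInnerProductSpace.Core ℂ A where
  inner x y := P.hHat (star x * y)
  conj_inner_symm x y := P.conj_hHat_star_mul x y
  re_inner_nonneg x := by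
    obtain ⟨r, hr, h⟩ := P.hHat_pos x
    simpa [h] using hr
  add_left x y z := by simp [add_mul]
  smul_left x y r := by simp

theorem hHat_faithful {x : A} (hx : P.hHat (star x * x) = 0) : x = 0 := by
  have h (y : A) : P.hHat (star x * y) = 0 := by
    let _ := P.hHatPreCore
    have h := InnerProductSpace.Core.inner_mul_inner_self_le (𝕜 := ℂ) x y
    change ‖P.hHat (star x * y)‖ * ‖P.hHat (star y * x)‖ ≤
      RCLike.re (P.hHat (star x * x)) * RCLike.re (P.hHat (star y * y)) at h
    rw [hx, ← P.conj_hHat_star_mul x y, RCLike.norm_conj, map_zero, zero_mul] at h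
    have h0 : P.hHat (star y * x) = 0 :=
      norm_eq_zero.mp (mul_self_eq_zero.mp (le_antisymm h (mul_self_nonneg _)))
    rw [← P.conj_hHat_star_mul x y, h0, map_zero]
  have h' (u : A ⊗[ℂ] A) : lapp P.hHat ((star x ⊗ₜ[ℂ] (1 : A)) * u) = 0 := by
    induction u with
    | zero => simp
    | tmul a b => simp [h]
    | add u v hu hv => simp only [map_add, hu, hv, mul_add, add_zero]
  exact star_eq_zero.mp ((P.lapp_hHat_dual (star x)).symm.trans (h' _))

/-- The inner product `(x, y) ↦ ⟨ĥ, x* y⟩`. -/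
@[reducible] def hHatCore : InnerProductSpace.Core ℂ A where
  toCore := P.hHatPreCore
  definite _ := P.hHat_faithful

theorem exists_iotaEl_eq_sum : ∃ (n : ℕ) (e : Fin n → A),
    P.iotaEl = ∑ i, e i * star (e i) ∧ ∀ y, ∃ c : Fin n → ℂ, y = ∑ i, c i • e i := by
  obtain ⟨n, e, he⟩ := P.hHatCore.exists_expansion
  replace he (y : A) : y = ∑ i, P.hHat (star (e i) * y) • e i := he y
  refine ⟨n, e, ?_, fun y => ⟨_, he y⟩⟩
  have h (u : A ⊗[ℂ] A) :
      u = ∑ i, e i ⊗ₜ[ℂ] lapp P.hHat ((star (e i) ⊗ₜ[ℂ] (1 : A)) * u) := by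
    induction u with
    | zero => simp
    | tmul a b =>
      conv_lhs => rw [he a]
      simp [TensorProduct.sum_tmul, TensorProduct.smul_tmul]
    | add u v hu hv =>
      conv_lhs => rw [hu, hv]
      simp only [mul_add, map_add, TensorProduct.tmul_add, Finset.sum_add_distrib]
  have h' := congrArg (LinearMap.mul' ℂ A) (h (TensorProduct.map LinearMap.id
    P.W.S.toLinearMap (P.W.Δ (P.h * (Ring.inverse P.gL * Ring.inverse P.gL)))))
  simp only [lapp_hHat_dual, map_sum, LinearMap.mul'_apply] at h'
  exact h'

theorem iotaEl_pos : IsPosElem P.iotaEl := by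
  let _ := cstarAlgebraOfFiniteDimensional A
  obtain ⟨n, e, he, -⟩ := P.exists_iotaEl_eq_sum
  rw [he]
  exact IsPosElem.sum fun i => ⟨star (e i), by rw [star_star]⟩

theorem isUnit_iotaEl : IsUnit P.iotaEl := by
  let _ := cstarAlgebraOfFiniteDimensional A
  obtain ⟨n, e, he, hspan⟩ := P.exists_iotaEl_eq_sum
  have hinj : Function.Injective (LinearMap.mulLeft ℂ P.iotaEl) := by
    refine (injective_iff_map_eq_zero _).mpr fun x hx => ?_
    rw [LinearMap.mulLeft_apply, he] at hx
    obtain ⟨c, hc⟩ := hspan 1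
    calc x = star (1 : A) * x := by simp
      _ = 0 := by
        rw [hc, star_sum, Finset.sum_mul]
        refine Finset.sum_eq_zero fun i _ => ?_
        rw [star_smul, smul_mul_assoc, IsPosElem.star_mul_eq_zero_of_sum_mul_eq_zero hx i,
          smul_zero]
  obtain ⟨y, hy⟩ := LinearMap.injective_iff_surjective.mp hinj 1
  exact ⟨⟨P.iotaEl, y, hy, (P.commute_iotaEl y).eq ▸ hy⟩, rfl⟩

theorem commute_inverse_iotaEl (x : A) : Commute (Ring.inverse P.iotaEl) x := by
  obtain ⟨u, hu⟩ := P.isUnit_iotaEl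
  have h := P.commute_iotaEl x
  rw [← hu] at h ⊢
  rw [Ring.inverse_unit]
  exact h.units_inv_left

theorem S_inverse_iotaEl : P.W.S (Ring.inverse P.iotaEl) = Ring.inverse P.iotaEl := by
  rw [P.S_inverse P.isUnit_iotaEl, S_iotaEl]

theorem actsOnLeftLeg_inverse_iotaEl : P.W.ActsOnLeftLeg (Ring.inverse P.iotaEl) :=
  P.actsOnLeftLeg_iotaEl.inverse P.isUnit_iotaEl

theorem actsOnRightLeg_inverse_iotaEl : P.W.ActsOnRightLeg (Ring.inverse P.iotaEl) :=
  P.S_inverse_iotaEl ▸ P.actsOnLeftLeg_inverse_iotaEl.actsOnRightLeg_S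

theorem Ω_eq_inverse_gR :
    P.Ω = Ring.inverse P.iotaEl * Ring.inverse P.gR * P.h * Ring.inverse P.gR := by
  rw [Ω, mul_assoc _ _ P.h, inverse_gL_mul_h, mul_assoc, mul_assoc, h_mul_inverse_gL]
  simp only [mul_assoc]

theorem star_inverse {a : A} (ha : IsPosElem a) : star (Ring.inverse a) = Ring.inverse a := by
  let _ := cstarAlgebraOfFiniteDimensional A
  rw [← Ring.inverse_star, ha.isSelfAdjoint]

theorem star_Ω : star P.Ω = P.Ω := by
  rw [Ω]
  simp only [star_mul, star_inverse P.gL_pos, star_inverse P.iotaEl_pos, P.haar_star]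
  simp only [← mul_assoc, ← (P.commute_inverse_iotaEl _).eq]

theorem Ω_mul_Ω : P.Ω * P.Ω = P.Ω := by
  have h : P.h * (Ring.inverse P.gL * Ring.inverse P.gL) * P.h = P.iotaEl * P.h :=
    P.haar_left _
  calc P.Ω * P.Ω = Ring.inverse P.iotaEl * Ring.inverse P.gL * P.h *
        (Ring.inverse P.gL * Ring.inverse P.iotaEl) * Ring.inverse P.gL * P.h *
          Ring.inverse P.gL := by simp only [Ω, mul_assoc]
    _ = Ring.inverse P.iotaEl * Ring.inverse P.gL * (P.h * Ring.inverse P.iotaEl) *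
        (Ring.inverse P.gL * Ring.inverse P.gL) * P.h * Ring.inverse P.gL := by
      rw [← (P.commute_inverse_iotaEl _).eq]
      simp only [mul_assoc]
    _ = Ring.inverse P.iotaEl * Ring.inverse P.gL * Ring.inverse P.iotaEl *
        (P.h * (Ring.inverse P.gL * Ring.inverse P.gL) * P.h) * Ring.inverse P.gL := by
      rw [← (P.commute_inverse_iotaEl _).eq]
      simp only [mul_assoc]
    _ = P.Ω := by
      rw [h, Ω]
      simp only [mul_assoc, Ring.inverse_mul_cancel_left _ _ P.isUnit_iotaEl]

theorem S_Ω : P.W.S P.Ω = P.Ω := by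
  conv_lhs => rw [Ω]
  rw [P.W.S_antimul, P.W.S_antimul, P.W.S_antimul, S_inverse_gL, P.haar_S, S_inverse_iotaEl,
    Ω_eq_inverse_gR, ← (P.commute_inverse_iotaEl _).eq]
  simp only [← mul_assoc, ← (P.commute_inverse_iotaEl _).eq]

theorem g_mul_Ω : P.g * P.Ω = P.Ω := by
  have h : Ring.inverse P.gR * (Ring.inverse P.gL * P.h) =
      Ring.inverse P.gL * (Ring.inverse P.gL * P.h) := by
    rw [← mul_assoc, ← P.commute_inverse_gL_inverse_gR.eq, mul_assoc, inverse_gL_mul_h]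
  have h' : P.g * (Ring.inverse P.gL * P.h) = Ring.inverse P.gL * P.h := by
    rw [g, mul_assoc, h, Ring.mul_inverse_cancel_left _ _ P.gL_unit]
  rw [Ω, mul_assoc _ _ P.h, ← mul_assoc, ← mul_assoc, ← (P.commute_inverse_iotaEl P.g).eq,
    mul_assoc _ P.g, h']

theorem sqrt_g_mul_Ω : P.sqrt P.g * P.Ω = P.Ω := by
  let _ := cstarAlgebraOfFiniteDimensional A
  have h := IsPosElem.mul_eq_of_mul_self_mul_eq (P.sqrt_pos _ P.isPosElem_g)
    (⟨1, by simp⟩ : IsPosElem (1 : A)) isUnit_one (Commute.one_right _) (h := P.Ω)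
    (by rw [P.sqrt_mul_self _ P.isPosElem_g, one_mul, one_mul]; exact P.g_mul_Ω)
  rwa [one_mul] at h

theorem isUnit_sqrt {a : A} (ha : IsPosElem a) (hu : IsUnit a) : IsUnit (P.sqrt a) := by
  rw [← isUnit_pow_iff two_ne_zero, pow_two, P.sqrt_mul_self a ha]
  exact hu

theorem Jlin_Ω : P.Jlin P.Ω = P.Ω := by
  let _ := cstarAlgebraOfFiniteDimensional A
  have hs : P.Ω * P.sqrt P.g = P.Ω := by
    have h := congrArg star P.sqrt_g_mul_Ω
    rwa [star_mul, star_Ω, (P.sqrt_pos _ P.isPosElem_g).isSelfAdjoint] at h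
  simp only [Jlin, LinearMap.comp_apply, LinearMap.mulRight_apply, LinearMap.mulLeft_apply,
    LinearEquiv.coe_coe, S_Ω]
  rw [ringInverse_mul_eq_self (P.isUnit_sqrt P.isPosElem_g P.isUnit_g) P.sqrt_g_mul_Ω, hs]

theorem Ω_eq_sqrt : P.Ω = Ring.inverse (P.sqrt (P.iotaEl * P.gL * P.gR)) * P.h *
    Ring.inverse (P.sqrt (P.iotaEl * P.gL * P.gR)) := by
  let _ := cstarAlgebraOfFiniteDimensional A
  have hιL : IsPosElem (P.iotaEl * P.gL) := P.iotaEl_pos.mul_of_commute P.gL_pos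
    (P.commute_iotaEl _)
  have hm : IsPosElem (P.iotaEl * P.gL * P.gR) := hιL.mul_of_commute P.gR_pos
    ((P.commute_iotaEl _).mul_left P.gLR_comm)
  set m := P.iotaEl * P.gL * P.gR with hm_def
  set s := P.sqrt P.iotaEl
  set k := P.sqrt m
  have hs : IsPosElem s := P.sqrt_pos _ P.iotaEl_pos
  have hss : s * s = P.iotaEl := P.sqrt_mul_self _ P.iotaEl_pos
  have hk : IsPosElem k := P.sqrt_pos _ hm
  have hkk : k * k = m := P.sqrt_mul_self _ hm
  have hsc (x : A) : Commute s x := hs.commute_of_mul_self hss (P.commute_iotaEl x)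
  have hr : IsPosElem (s * P.gL) := hs.mul_of_commute P.gL_pos (hsc _)
  have hsu : IsUnit s := P.isUnit_sqrt P.iotaEl_pos P.isUnit_iotaEl
  have hru : IsUnit (s * P.gL) := hsu.mul P.gL_unit
  have hku : IsUnit k := P.isUnit_sqrt hm ((P.isUnit_iotaEl.mul P.gL_unit).mul P.gR_unit)
  have hmL : Commute m P.gL :=
    ((P.commute_iotaEl _).mul_left (Commute.refl _)).mul_left P.gLR_comm.symm
  have hkr : Commute k (s * P.gL) :=
    ((hsc k).symm).mul_right (hk.commute_of_mul_self hkk hmL)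
  have hrr : (s * P.gL) * (s * P.gL) = P.iotaEl * P.gL * P.gL := by
    rw [mul_assoc, ← mul_assoc P.gL, ← (hsc P.gL).eq, ← hss]
    simp only [mul_assoc]
  have hkh : k * P.h = s * P.gL * P.h := hk.mul_eq_of_mul_self_mul_eq hr hru hkr <| by
    rw [hkk, hrr, hm_def, mul_assoc, ← gL_mul_h, mul_assoc _ P.gL P.h]
  have hhk : P.h * k = P.h * (s * P.gL) := by
    have h := congrArg star hkh
    rwa [star_mul, star_mul (s * P.gL), hk.isSelfAdjoint, hr.isSelfAdjoint, P.haar_star] at h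
  rw [ringInverse_mul_eq_of_mul_eq hku hru hkr hkh, mul_assoc,
    mul_ringInverse_eq_of_mul_eq hku hru hkr hhk, Ring.mul_inverse_rev' (hsc _), ← mul_assoc, Ω,
    ← hss, Ring.mul_inverse_rev' (Commute.refl s)]
  have hsi (x : A) : Ring.inverse s * x = x * Ring.inverse s := by
    obtain ⟨u, hu⟩ := hsu
    have h := hsc x
    rw [← hu] at h ⊢
    rw [Ring.inverse_unit]
    exact h.units_inv_left
  simp only [← mul_assoc, ← hsi]

theorem Δ_Ω : P.W.Δ P.Ω = ((Ring.inverse P.iotaEl * Ring.inverse P.gL) ⊗ₜ[ℂ] (1 : A)) *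
    P.W.Δ P.h * (Ring.inverse P.gL ⊗ₜ[ℂ] (1 : A)) := by
  rw [Ω, (P.actsOnLeftLeg_inverse_gL _).2,
    ((P.actsOnLeftLeg_inverse_iotaEl.mul P.actsOnLeftLeg_inverse_gL) _).1]

theorem Δ_Ω' : P.W.Δ P.Ω = ((1 : A) ⊗ₜ[ℂ] (Ring.inverse P.iotaEl * Ring.inverse P.gR)) *
    P.W.Δ P.h * ((1 : A) ⊗ₜ[ℂ] Ring.inverse P.gR) := by
  rw [Ω_eq_inverse_gR, (P.actsOnRightLeg_inverse_gR _).2, mul_assoc _ _ P.h,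
    (P.actsOnRightLeg_inverse_iotaEl _).1, (P.actsOnRightLeg_inverse_gR _).1, ← mul_assoc,
    Algebra.TensorProduct.tmul_mul_tmul, one_mul]

theorem Δ_Ω_cocentral : P.W.Δ P.Ω = TensorProduct.comm ℂ A A (P.W.Δ P.Ω) := by
  have hcomm (a b : A) (u : A ⊗[ℂ] A) :
      TensorProduct.comm ℂ A A ((a ⊗ₜ[ℂ] (1 : A)) * u * (b ⊗ₜ[ℂ] (1 : A))) =
      ((1 : A) ⊗ₜ[ℂ] a) * TensorProduct.comm ℂ A A u * ((1 : A) ⊗ₜ[ℂ] b) := by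
    induction u with
    | zero => simp
    | tmul c d => simp
    | add u v hu hv => simp only [map_add, hu, hv, mul_add, add_mul]
  have hmap (u : A ⊗[ℂ] A) : TensorProduct.map LinearMap.id
      (LinearMap.mulLeft ℂ P.g ∘ₗ LinearMap.mulRight ℂ P.g) u =
      ((1 : A) ⊗ₜ[ℂ] P.g) * u * ((1 : A) ⊗ₜ[ℂ] P.g) := by
    induction u with
    | zero => simp
    | tmul c d => simp [mul_assoc]
    | add u v hu hv => simp only [map_add, hu, hv, mul_add, add_mul]
  have hflip : ((1 : A) ⊗ₜ[ℂ] P.g) * P.W.Δ P.h * ((1 : A) ⊗ₜ[ℂ] P.g) =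
      TensorProduct.comm ℂ A A (P.W.Δ P.h) := (hmap _).symm.trans P.haar_flip
  have h1 : Ring.inverse P.iotaEl * Ring.inverse P.gL * P.g =
      Ring.inverse P.iotaEl * Ring.inverse P.gR := by
    rw [g, mul_assoc, Ring.inverse_mul_cancel_left _ _ P.gL_unit]
  have h2 : P.g * Ring.inverse P.gL = Ring.inverse P.gR := by
    rw [g, P.commute_gL_inverse_gR.eq, mul_assoc, gL_mul_inverse, mul_one]
  conv_rhs => rw [Δ_Ω, hcomm, ← hflip]
  rw [Δ_Ω', ← mul_assoc, ← mul_assoc, Algebra.TensorProduct.tmul_mul_tmul, one_mul, h1,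
    mul_assoc _ ((1 : A) ⊗ₜ[ℂ] P.g), Algebra.TensorProduct.tmul_mul_tmul, one_mul, h2]

theorem Ω_nondegenerate (y : A) :
    ∃ φ ψ : A →ₗ[ℂ] ℂ, lapp φ (P.W.Δ P.Ω) = y ∧ rapp ψ (P.W.Δ P.Ω) = y := by
  obtain ⟨φ, -, hφ, -⟩ := P.haar_nondeg y
  obtain ⟨-, ψ, -, hψ⟩ := P.haar_nondeg (P.gL * P.iotaEl * y * P.gL)
  refine ⟨φ ∘ₗ LinearMap.mulLeft ℂ (P.gL * P.iotaEl) ∘ₗ LinearMap.mulRight ℂ P.gL, ψ, ?_, ?_⟩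
  · rw [Δ_Ω, lapp_tmul_one_mul_mul]
    refine Eq.trans (congrArg (fun χ => lapp χ (P.W.Δ P.h)) (LinearMap.ext fun x => ?_)) hφ
    simp only [LinearMap.comp_apply, LinearMap.mulLeft_apply, LinearMap.mulRight_apply, mul_assoc,
      inverse_mul_gL, mul_one, Ring.mul_inverse_cancel_left _ _ P.isUnit_iotaEl,
      Ring.mul_inverse_cancel_left _ _ P.gL_unit]
  · rw [Δ_Ω, rapp_tmul_one_mul_mul, hψ]
    simp only [mul_assoc, gL_mul_inverse, mul_one,
      Ring.inverse_mul_cancel_left _ _ P.isUnit_iotaEl,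
      Ring.inverse_mul_cancel_left _ _ P.gL_unit]

end HaarPkg

/-- **Properties of the pulling-through element `Ω = ı⁻¹ gL⁻¹ h gL⁻¹`.**
(1) `Ω = ı⁻¹ gR⁻¹ h gR⁻¹ = (ı gL gR)^{-1/2} h (ı gL gR)^{-1/2}`; (2) `Ω` is positive;
(3) `Ω² = Ω = Ω* = S Ω = J Ω`; (4) `Ω` is cocentral; (5) `Ω` is non-degenerate. -/
theorem HaarPkg.omega_properties {A : Type*} [NormedRing A] [StarRing A] [CStarRing A]
    [NormedAlgebra ℂ A] [StarModule ℂ A] [FiniteDimensional ℂ A]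
    (P : HaarPkg A) :
    P.Ω = Ring.inverse P.iotaEl * Ring.inverse P.gR * P.h * Ring.inverse P.gR ∧
    P.Ω = Ring.inverse (P.sqrt (P.iotaEl * P.gL * P.gR)) * P.h *
        Ring.inverse (P.sqrt (P.iotaEl * P.gL * P.gR)) ∧
    IsPosElem P.Ω ∧
    P.Ω * P.Ω = P.Ω ∧ star P.Ω = P.Ω ∧ P.W.S P.Ω = P.Ω ∧ P.Jlin P.Ω = P.Ω ∧
    P.W.Δ P.Ω = (TensorProduct.comm ℂ A A) (P.W.Δ P.Ω) ∧
    (∀ y : A, ∃ φ ψ : A →ₗ[ℂ] ℂ, lapp φ (P.W.Δ P.Ω) = y ∧ rapp ψ (P.W.Δ P.Ω) = y) := by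
  exact ⟨P.Ω_eq_inverse_gR, P.Ω_eq_sqrt, ⟨P.Ω, by rw [P.star_Ω, P.Ω_mul_Ω]⟩, P.Ω_mul_Ω, P.star_Ω,
    P.S_Ω, P.Jlin_Ω, P.Δ_Ω_cocentral, P.Ω_nondegenerate⟩

end
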